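/- Let A be a vertical bicomplex over R (viewed as a twisted complex whose only non-zero structure map is d_0 = d^A), and let B, C be twisted complexes. Then there is a natural bijection Hom_{tc}(A⊗B, C) ≅ Hom_{vbic}(A, wtc(B,C)): a morphism of twisted complexes f = (f_m) : A⊗B → C corresponds to the morphism of vertical bicomplexes f̃ : A → wtc(B,C) given on a ∈ A_u^v by (f̃(a))_m(b) := (−1)^{m|a|} f_m(a⊗b), where |a| = v − u; in particular δ(f̃(a)) = f̃(d^A(a)). -/

import Mathlib

open Finset

noncomputable section

/-- A `(ℤ,ℤ)`-bigraded `R`-module. -/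
structure Bigraded (R : Type) [CommRing R] where
  M : ℤ → ℤ → Type
  [acg : ∀ i j, AddCommGroup (M i j)]
  [mod : ∀ i j, Module R (M i j)]

attribute [instance] Bigraded.acg Bigraded.mod

variable {R : Type} [CommRing R]

/-- Transport along equalities of bidegrees. -/
def Bigraded.cast (A : Bigraded R) {i i' j j' : ℤ} (hi : i = i') (hj : j = j') :
    A.M i j →ₗ[R] A.M i' j' := by subst hi; subst hj; exact LinearMap.id

/-- Maps of bigraded modules of bidegree `(p,q)`. -/
abbrev GMap (A B : Bigraded R) (p q : ℤ) : Type :=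
  ∀ i j : ℤ, A.M i j →ₗ[R] B.M (i + p) (j + q)

/-- Change the recorded bidegree of a graded map along equalities of bidegrees. -/
def grecast {A B : Bigraded R} {p q : ℤ} (p' q' : ℤ) (hp : p = p') (hq : q = q')
    (f : GMap A B p q) : GMap A B p' q' :=
  fun i j => (B.cast (by rw [hp]) (by rw [hq])).comp (f i j)

/-- Composition of graded maps: apply `f` first, then `g`. -/
def gcomp {A B C : Bigraded R} {p q p' q' : ℤ} (g : GMap B C p' q') (f : GMap A B p q) :
    GMap A C (p + p') (q + q') :=
  fun i j => (C.cast (by ring) (by ring)).comp ((g (i + p) (j + q)).comp (f i j))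

/-- The identity as a graded map of bidegree `(0,0)`. -/
def idG (A : Bigraded R) : GMap A A 0 0 := fun i j => A.cast (by ring) (by ring)

/-- An element of `wbimod(A,B)_u^v`, i.e. a family of bigraded maps `f_m : A → B` of
bidegree `(u-m, v-m)` for `m ≥ 0`. -/
abbrev WMap (A B : Bigraded R) (u v : ℤ) : Type :=
  ∀ m : ℕ, GMap A B (u - (m : ℤ)) (v - (m : ℤ))

/-- The family of maps `(d_m)` makes `A` into a twisted complex:
`∑_{i+j=m} (-1)^i d_i d_j = 0` for all `m ≥ 0`. -/
def IsTwDiff (A : Bigraded R) (d : WMap A A 0 1) : Prop :=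
  ∀ m : ℕ, ∑ ij ∈ (antidiagonal m).attach,
      ((-1 : ℤ) ^ ij.1.1) •
        grecast (0 - (m : ℤ)) (2 - (m : ℤ))
          (by have := mem_antidiagonal.mp ij.2; omega)
          (by have := mem_antidiagonal.mp ij.2; omega)
          (gcomp (d ij.1.1) (d ij.1.2)) = 0

/-- The family `(f_m)` is a morphism of twisted complexes from `(A, dA)` to `(B, dB)`:
`∑_{i+j=m} d_i^B f_j = ∑_{i+j=m} (-1)^i f_i d_j^A` for all `m ≥ 0`. -/
def IsTwMor {A B : Bigraded R} (dA : WMap A A 0 1) (dB : WMap B B 0 1)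
    (f : WMap A B 0 0) : Prop :=
  ∀ m : ℕ,
    (∑ ij ∈ (antidiagonal m).attach,
      grecast (0 - (m : ℤ)) (1 - (m : ℤ))
        (by have := mem_antidiagonal.mp ij.2; omega)
        (by have := mem_antidiagonal.mp ij.2; omega)
        (gcomp (dB ij.1.1) (f ij.1.2)))
    = ∑ ij ∈ (antidiagonal m).attach,
      ((-1 : ℤ) ^ ij.1.1) •
        grecast (0 - (m : ℤ)) (1 - (m : ℤ))
          (by have := mem_antidiagonal.mp ij.2; omega)
          (by have := mem_antidiagonal.mp ij.2; omega)
          (gcomp (f ij.1.1) (dA ij.1.2))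

/-- A twisted complex (multicomplex) over `R`. -/
structure TwComplex (R : Type) [CommRing R] extends Bigraded R where
  d : WMap toBigraded toBigraded 0 1
  isTw : IsTwDiff toBigraded d

/-- A morphism of twisted complexes. -/
structure TwMorphism (A B : TwComplex R) where
  f : WMap A.toBigraded B.toBigraded 0 0
  isMor : IsTwMor A.d B.d f

/-- Composition of families: `(g ∘ f)_m = ∑_{i+j=m} g_i f_j`. -/
def compFam {A B C : Bigraded R} (g : WMap B C 0 0) (f : WMap A B 0 0) : WMap A C 0 0 :=
  fun m => ∑ ij ∈ (antidiagonal m).attach,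
    grecast (0 - (m : ℤ)) (0 - (m : ℤ))
      (by have := mem_antidiagonal.mp ij.2; omega)
      (by have := mem_antidiagonal.mp ij.2; omega)
      (gcomp (g ij.1.1) (f ij.1.2))

/-- A strict family: concentrated in stage `0`. -/
def strictW {A B : Bigraded R} (g : GMap A B 0 0) : WMap A B 0 0 :=
  fun m => if h : m = 0 then grecast (0 - (m : ℤ)) (0 - (m : ℤ)) (by omega) (by omega) g else 0

/-- The identity family of maps. -/
def idW (A : Bigraded R) : WMap A A 0 0 := strictW (idG A)

/-! ## Tensor product of bigraded modules and twisted complexes -/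

open DirectSum in
/-- Tensor product of bigraded modules: `(A ⊗ B)_i^j = ⊕_{p,q} A_p^q ⊗ B_{i-p}^{j-q}`. -/
def tensorBG (A B : Bigraded R) : Bigraded R where
  M i j := ⨁ pq : ℤ × ℤ, TensorProduct R (A.M pq.1 pq.2) (B.M (i - pq.1) (j - pq.2))
  acg := fun _ _ => inferInstance
  mod := fun _ _ => inferInstance

/-- Koszul tensor product of graded maps:
`(f ⊗ g)(a ⊗ b) = (-1)^{⟨g,a⟩} f(a) ⊗ g(b)` where `⟨x,y⟩ = x₁y₁ + x₂y₂` on bidegrees. -/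
def gtensor {A A' B B' : Bigraded R} {p q p' q' : ℤ}
    (f : GMap A A' p q) (g : GMap B B' p' q') :
    GMap (tensorBG A B) (tensorBG A' B') (p + p') (q + q') :=
  fun i j => DirectSum.toModule R (ℤ × ℤ) ((tensorBG A' B').M (i + (p + p')) (j + (q + q')))
    (fun st =>
      (DirectSum.lof R (ℤ × ℤ)
          (fun pq => TensorProduct R (A'.M pq.1 pq.2)
            (B'.M (i + (p + p') - pq.1) (j + (q + q') - pq.2)))
          (st.1 + p, st.2 + q)).comp
        (((Int.negOnePow (p' * st.1 + q' * st.2) : ℤ) •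
          TensorProduct.map (f st.1 st.2)
            ((B'.cast (by ring) (by ring)).comp (g (i - st.1) (j - st.2))))))

/-- Structure maps of the tensor product of twisted complexes:
`∂_m := d^A_m ⊗ 1 + 1 ⊗ d^B_m` (with the Koszul sign rule). -/
def tensorD {A B : Bigraded R} (dA : WMap A A 0 1) (dB : WMap B B 0 1) :
    WMap (tensorBG A B) (tensorBG A B) 0 1 :=
  fun m => grecast (0 - (m : ℤ)) (1 - (m : ℤ)) (by ring) (by ring) (gtensor (dA m) (idG B))
    + grecast (0 - (m : ℤ)) (1 - (m : ℤ)) (by ring) (by ring) (gtensor (idG A) (dB m))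

/-- Tensor product of morphism families: `(f ⊗ g)_m := ∑_{i+j=m} f_i ⊗ g_j`. -/
def tensorFamW {A A' B B' : Bigraded R} (f : WMap A A' 0 0) (g : WMap B B' 0 0) :
    WMap (tensorBG A B) (tensorBG A' B') 0 0 :=
  fun m => ∑ ij ∈ (antidiagonal m).attach,
    grecast (0 - (m : ℤ)) (0 - (m : ℤ))
      (by have := mem_antidiagonal.mp ij.2; omega)
      (by have := mem_antidiagonal.mp ij.2; omega)
      (gtensor (f ij.1.1) (g ij.1.2))


/-! ## The enriched hom `wbimod` : composition and differential -/

/-- Composition in `wbimod` : `c(f,g)_m := ∑_{i+j=m} (-1)^{i|g|} f_i g_j`, where `|g| = v' - u'`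
is the total degree of `g`. -/
def wcomp {A B C : Bigraded R} {u v u' v' : ℤ} (f : WMap B C u v) (g : WMap A B u' v') :
    WMap A C (u + u') (v + v') :=
  fun m => ∑ ij ∈ (antidiagonal m).attach,
    (Int.negOnePow ((ij.1.1 : ℤ) * (v' - u')) : ℤ) •
      grecast ((u + u') - (m : ℤ)) ((v + v') - (m : ℤ))
        (by have := mem_antidiagonal.mp ij.2; omega)
        (by have := mem_antidiagonal.mp ij.2; omega)
        (gcomp (f ij.1.1) (g ij.1.2))

/-- Change the recorded bidegree of a `wbimod` element. -/
def wrecast {A B : Bigraded R} {u v : ℤ} (u' v' : ℤ) (hu : u = u') (hv : v = v')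
    (f : WMap A B u v) : WMap A B u' v' :=
  fun m => grecast (u' - (m : ℤ)) (v' - (m : ℤ)) (by rw [hu]) (by rw [hv]) (f m)

/-- The vertical differential on `wbimod(A,B)` induced by twisted-complex structures:
`δ(f) := c(d^B, f) - (-1)^{⟨f, d^A⟩} c(f, d^A)`. -/
def wdelta {A B : Bigraded R} (dA : WMap A A 0 1) (dB : WMap B B 0 1) {u v : ℤ}
    (f : WMap A B u v) : WMap A B u (v + 1) :=
  wrecast u (v + 1) (by ring) (by ring) (wcomp dB f)
  - (Int.negOnePow (u * 0 + v * 1) : ℤ) • wrecast u (v + 1) (by ring) (by ring) (wcomp f dA)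

theorem gcomp_add_right {A B C : Bigraded R} {p q p' q' : ℤ} (g : GMap B C p' q')
    (f₁ f₂ : GMap A B p q) : gcomp g (f₁ + f₂) = gcomp g f₁ + gcomp g f₂ := by
  funext i j; ext x; simp [gcomp]

theorem gcomp_add_left {A B C : Bigraded R} {p q p' q' : ℤ} (g₁ g₂ : GMap B C p' q')
    (f : GMap A B p q) : gcomp (g₁ + g₂) f = gcomp g₁ f + gcomp g₂ f := by
  funext i j; ext x; simp [gcomp]

theorem gcomp_smul_right {A B C : Bigraded R} {p q p' q' : ℤ} (c : R) (g : GMap B C p' q')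
    (f : GMap A B p q) : gcomp g (c • f) = c • gcomp g f := by
  funext i j; ext x; simp [gcomp]

theorem gcomp_smul_left {A B C : Bigraded R} {p q p' q' : ℤ} (c : R) (g : GMap B C p' q')
    (f : GMap A B p q) : gcomp (c • g) f = c • gcomp g f := by
  funext i j; ext x; simp [gcomp]

theorem grecast_add {A B : Bigraded R} {p q : ℤ} (p' q' : ℤ) (hp : p = p') (hq : q = q')
    (f₁ f₂ : GMap A B p q) :
    grecast p' q' hp hq (f₁ + f₂) = grecast p' q' hp hq f₁ + grecast p' q' hp hq f₂ := by
  funext i j; ext x; simp [grecast]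

theorem grecast_smul {A B : Bigraded R} {p q : ℤ} (p' q' : ℤ) (hp : p = p') (hq : q = q')
    (c : R) (f : GMap A B p q) :
    grecast p' q' hp hq (c • f) = c • grecast p' q' hp hq f := by
  funext i j; ext x; simp [grecast]

theorem wcomp_add_right {A B C : Bigraded R} {u v u' v' : ℤ} (f : WMap B C u v)
    (g₁ g₂ : WMap A B u' v') : wcomp f (g₁ + g₂) = wcomp f g₁ + wcomp f g₂ := by
  funext m
  simp [wcomp, Pi.add_apply, gcomp_add_right, grecast_add, smul_add, Finset.sum_add_distrib]

theorem wcomp_smul_right {A B C : Bigraded R} {u v u' v' : ℤ} (c : R) (f : WMap B C u v)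
    (g : WMap A B u' v') : wcomp f (c • g) = c • wcomp f g := by
  funext m
  simp only [wcomp, Pi.smul_apply, gcomp_smul_right, grecast_smul, Finset.smul_sum]
  exact Finset.sum_congr rfl fun ij _ => smul_comm _ _ _

theorem wcomp_add_left {A B C : Bigraded R} {u v u' v' : ℤ} (f₁ f₂ : WMap B C u v)
    (g : WMap A B u' v') : wcomp (f₁ + f₂) g = wcomp f₁ g + wcomp f₂ g := by
  funext m
  simp [wcomp, Pi.add_apply, gcomp_add_left, grecast_add, smul_add, Finset.sum_add_distrib]

theorem wcomp_smul_left {A B C : Bigraded R} {u v u' v' : ℤ} (c : R) (f : WMap B C u v)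
    (g : WMap A B u' v') : wcomp (c • f) g = c • wcomp f g := by
  funext m
  simp only [wcomp, Pi.smul_apply, gcomp_smul_left, grecast_smul, Finset.smul_sum]
  exact Finset.sum_congr rfl fun ij _ => smul_comm _ _ _

theorem wrecast_add {A B : Bigraded R} {u v : ℤ} (u' v' : ℤ) (hu : u = u') (hv : v = v')
    (f₁ f₂ : WMap A B u v) :
    wrecast u' v' hu hv (f₁ + f₂) = wrecast u' v' hu hv f₁ + wrecast u' v' hu hv f₂ := by
  funext m; simp [wrecast, Pi.add_apply, grecast_add]

theorem wrecast_smul {A B : Bigraded R} {u v : ℤ} (u' v' : ℤ) (hu : u = u') (hv : v = v')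
    (c : R) (f : WMap A B u v) :
    wrecast u' v' hu hv (c • f) = c • wrecast u' v' hu hv f := by
  funext m; simp [wrecast, Pi.smul_apply, grecast_smul]

/-- `wrecast` as a linear map. -/
def wrecastL {A B : Bigraded R} {u v : ℤ} (u' v' : ℤ) (hu : u = u') (hv : v = v') :
    WMap A B u v →ₗ[R] WMap A B u' v' where
  toFun := wrecast u' v' hu hv
  map_add' := wrecast_add u' v' hu hv
  map_smul' c f := wrecast_smul u' v' hu hv c f

/-- The underlying bigraded module of the inner hom `wtc(B,C)`. -/
def wtcBG (B C : Bigraded R) : Bigraded R where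
  M u v := WMap B C u v
  acg := fun _ _ => inferInstance
  mod := fun _ _ => inferInstance

/-- `δ` as a linear map on each bidegree component of `wtc(B,C)`. -/
def wtcDeltaComp {B C : Bigraded R} (dB : WMap B B 0 1) (dC : WMap C C 0 1) (u v : ℤ) :
    WMap B C u v →ₗ[R] WMap B C u (v + 1) where
  toFun f := wdelta dB dC f
  map_add' f₁ f₂ := by
    simp only [wdelta, wcomp_add_right, wcomp_add_left, wrecast_add, smul_add]
    abel
  map_smul' c f := by
    simp only [wdelta, wcomp_smul_right, wcomp_smul_left, wrecast_smul, RingHom.id_apply]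
    rw [smul_comm ((Int.negOnePow (u * 0 + v * 1) : ℤˣ) : ℤ) c, smul_sub]

/-- The vertical differential of the vertical bicomplex `wtc(B,C)`. -/
def wtcD {B C : Bigraded R} (dB : WMap B B 0 1) (dC : WMap C C 0 1) :
    GMap (wtcBG B C) (wtcBG B C) 0 1 :=
  fun u v => (wrecastL (u + 0) (v + 1) (by ring) (by ring)).comp (wtcDeltaComp dB dC u v)

/-- A vertical bicomplex `(A, d_0)`, regarded as a twisted complex. -/
def vbW {A : Bigraded R} (d0 : GMap A A 0 1) : WMap A A 0 1 :=
  fun m => if h : m = 0 then grecast (0 - (m : ℤ)) (1 - (m : ℤ)) (by omega) (by omega) d0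
    else 0

/-- A morphism of vertical bicomplexes: a bidegree `(0,0)` map commuting with the
vertical differentials. -/
def IsVbMor {A W : Bigraded R} (dA0 : GMap A A 0 1) (dW : GMap W W 0 1)
    (g : GMap A W 0 0) : Prop :=
  grecast 0 1 (by ring) (by ring) (gcomp dW g) = grecast 0 1 (by ring) (by ring) (gcomp g dA0)

open DirectSum in
/-- The identity of the tensor product, bridging the two presentations of its type. -/
def tbridge (A B : Bigraded R) (i j : ℤ) :
    (⨁ pq : ℤ × ℤ, TensorProduct R (A.M pq.1 pq.2) (B.M (i - pq.1) (j - pq.2))) →ₗ[R]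
      (tensorBG A B).M i j := LinearMap.id

/-- The adjoint `f̃` of a map `f : A ⊗ B → C`: `(f̃(a))_m(b) := (-1)^{m|a|} f_m(a ⊗ b)`,
as a bidegree-component family of linear maps. -/
def tildeComp {A B C : Bigraded R} (f : WMap (tensorBG A B) C 0 0) (u v : ℤ) :
    A.M u v →ₗ[R] WMap B C (u + 0) (v + 0) where
  toFun a := fun m i j =>
    (Int.negOnePow ((m : ℤ) * (v - u)) : ℤ) •
      (C.cast (by ring) (by ring)).comp
        ((f m (u + i) (v + j)).comp
          ((tbridge A B (u + i) (v + j)).comp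
            ((DirectSum.lof R (ℤ × ℤ)
                (fun pq => TensorProduct R (A.M pq.1 pq.2)
                  (B.M ((u + i) - pq.1) ((v + j) - pq.2))) (u, v)).comp
              ((TensorProduct.mk R (A.M u v) (B.M ((u + i) - u) ((v + j) - v)) a).comp
                (B.cast (by ring) (by ring))))))
  map_add' a₁ a₂ := by
    funext m i j
    ext b
    simp [TensorProduct.add_tmul]
  map_smul' c a := by
    funext m i j
    ext b
    simp only [LinearMap.smul_apply, LinearMap.coe_comp, Function.comp_apply,
      RingHom.id_apply, Pi.smul_apply, TensorProduct.mk_apply]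
    rw [← TensorProduct.smul_tmul', map_smul, map_smul, map_smul, map_smul, smul_comm]

/-- The adjoint `f̃ : A → wtc(B,C)` of `f : A ⊗ B → C`. -/
def tildeMap {A B C : Bigraded R} (f : WMap (tensorBG A B) C 0 0) :
    GMap A (wtcBG B C) 0 0 :=
  fun u v => tildeComp f u v

open DirectSum in
/-- The total module of a bigraded module. -/
abbrev Bigraded.Tot (A : Bigraded R) : Type := ⨁ p : ℤ × ℤ, A.M p.1 p.2

/-- The inclusion of a bidegree component in the total module. -/
def Bigraded.incl (A : Bigraded R) (i j : ℤ) : A.M i j →ₗ[R] A.Tot :=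
  DirectSum.lof R (ℤ × ℤ) (fun p => A.M p.1 p.2) (i, j)

theorem Bigraded.incl_injective (A : Bigraded R) (i j : ℤ) :
    Function.Injective (A.incl i j) :=
  DirectSum.of_injective (β := fun p : ℤ × ℤ => A.M p.1 p.2) (i, j)

@[simp]
theorem Bigraded.incl_cast (A : Bigraded R) {i i' j j' : ℤ} (hi : i = i') (hj : j = j')
    (x : A.M i j) : A.incl i' j' (A.cast hi hj x) = A.incl i j x := by
  subst hi hj; rfl

theorem Bigraded.cast_cast (A : Bigraded R) {i i' i'' j j' j'' : ℤ} (hi : i = i')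
    (hj : j = j') (hi' : i' = i'') (hj' : j' = j'') (x : A.M i j) :
    A.cast hi' hj' (A.cast hi hj x) = A.cast (hi.trans hi') (hj.trans hj') x := by
  subst hi hj hi' hj'; rfl

theorem Bigraded.tot_hom_ext {A : Bigraded R} {N : Type} [AddCommGroup N] [Module R N]
    {f g : A.Tot →ₗ[R] N} (h : ∀ i j x, f (A.incl i j x) = g (A.incl i j x)) : f = g :=
  DirectSum.linearMap_ext R fun p => LinearMap.ext fun x => h p.1 p.2 x

/-- The map of total modules induced by a map of bigraded modules. -/
def totMap {A B : Bigraded R} {p q : ℤ} : GMap A B p q →ₗ[R] (A.Tot →ₗ[R] B.Tot) where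
  toFun f := DirectSum.toModule R (ℤ × ℤ) B.Tot
    fun ij => (B.incl (ij.1 + p) (ij.2 + q)).comp (f ij.1 ij.2)
  map_add' f g := by
    apply Bigraded.tot_hom_ext
    intro i j x
    simp [Bigraded.incl]
  map_smul' c f := by
    apply Bigraded.tot_hom_ext
    intro i j x
    simp [Bigraded.incl]

@[simp]
theorem totMap_incl {A B : Bigraded R} {p q : ℤ} (f : GMap A B p q) (i j : ℤ) (x : A.M i j) :
    totMap f (A.incl i j x) = B.incl (i + p) (j + q) (f i j x) := by
  simp [totMap, Bigraded.incl]

theorem totMap_injective {A B : Bigraded R} {p q : ℤ} :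
    Function.Injective (totMap : GMap A B p q →ₗ[R] _) := by
  intro f g h
  funext i j
  ext x
  apply B.incl_injective
  rw [← totMap_incl, h, totMap_incl]

theorem totMap_grecast {A B : Bigraded R} {p q p' q' : ℤ} (hp : p = p') (hq : q = q')
    (f : GMap A B p q) : totMap (grecast p' q' hp hq f) = totMap f := by
  apply Bigraded.tot_hom_ext
  intro i j x
  simp [grecast]

theorem totMap_gcomp {A B C : Bigraded R} {p q p' q' : ℤ} (g : GMap B C p' q')
    (f : GMap A B p q) : totMap (gcomp g f) = (totMap g).comp (totMap f) := by
  apply Bigraded.tot_hom_ext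
  intro i j x
  simp [gcomp]

theorem totMap_idG (A : Bigraded R) : totMap (idG A) = LinearMap.id := by
  apply Bigraded.tot_hom_ext
  intro i j x
  simp [idG]

theorem totMap_wrecast {A B : Bigraded R} {u v u' v' : ℤ} (hu : u = u') (hv : v = v')
    (f : WMap A B u v) (m : ℕ) : totMap (wrecast u' v' hu hv f m) = totMap (f m) :=
  totMap_grecast _ _ _

theorem totMap_wcomp {A B C : Bigraded R} {u v u' v' : ℤ} (f : WMap B C u v)
    (g : WMap A B u' v') (m : ℕ) :
    totMap (wcomp f g m) = ∑ ij ∈ antidiagonal m,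
      (Int.negOnePow ((ij.1 : ℤ) * (v' - u')) : ℤ) •
        (totMap (f ij.1)).comp (totMap (g ij.2)) := by
  rw [← Finset.sum_attach]
  simp only [wcomp, map_sum, map_zsmul, totMap_grecast, totMap_gcomp]

theorem totMap_wdelta {A B : Bigraded R} (dA : WMap A A 0 1) (dB : WMap B B 0 1) {u v : ℤ}
    (f : WMap A B u v) (m : ℕ) :
    totMap (wdelta dA dB f m) =
      ∑ ij ∈ antidiagonal m, (Int.negOnePow ((ij.1 : ℤ) * (v - u)) : ℤ) •
        (totMap (dB ij.1)).comp (totMap (f ij.2))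
      - (Int.negOnePow v : ℤ) • ∑ ij ∈ antidiagonal m, (Int.negOnePow (ij.1 : ℤ) : ℤ) •
        (totMap (f ij.1)).comp (totMap (dA ij.2)) := by
  simp only [wdelta, Pi.sub_apply, Pi.smul_apply, map_sub, map_zsmul, totMap_wrecast,
    totMap_wcomp, mul_zero, zero_add, mul_one, sub_zero]

theorem totMap_wtcBG_cast {B C : Bigraded R} {u v u' v' : ℤ} (hu : u = u') (hv : v = v')
    (w : WMap B C u v) (m : ℕ) :
    totMap (((wtcBG B C).cast hu hv w : WMap B C u' v') m) = totMap (w m) := by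
  subst hu hv; rfl

/-- The pairing `(a, b) ↦ a ⊗ b` on total modules. -/
def totTensor (A B : Bigraded R) : A.Tot →ₗ[R] B.Tot →ₗ[R] (tensorBG A B).Tot :=
  DirectSum.toModule R (ℤ × ℤ) _ fun uv =>
    LinearMap.flip <| DirectSum.toModule R (ℤ × ℤ) _ fun ij =>
      LinearMap.flip <|
        (TensorProduct.mk R (A.M uv.1 uv.2) (B.M ij.1 ij.2)).compr₂
          ((((tensorBG A B).incl (uv.1 + ij.1) (uv.2 + ij.2)).comp
            (tbridge A B (uv.1 + ij.1) (uv.2 + ij.2))).comp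
            ((DirectSum.lof R (ℤ × ℤ)
              (fun pq => TensorProduct R (A.M pq.1 pq.2)
                (B.M ((uv.1 + ij.1) - pq.1) ((uv.2 + ij.2) - pq.2))) uv).comp
              (TensorProduct.map LinearMap.id (B.cast (by ring) (by ring)))))

theorem totTensor_incl {A B : Bigraded R} {u v i j I J : ℤ} (hI : I = u + i) (hJ : J = v + j)
    (a : A.M u v) (b : B.M i j) :
    totTensor A B (A.incl u v a) (B.incl i j b) =
      (tensorBG A B).incl I J (tbridge A B I J
        (DirectSum.lof R (ℤ × ℤ)
          (fun pq => TensorProduct R (A.M pq.1 pq.2) (B.M (I - pq.1) (J - pq.2))) (u, v)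
          (a ⊗ₜ[R] B.cast (by omega) (by omega) b))) := by
  subst hI hJ
  simp [totTensor, Bigraded.incl]

theorem tensorBG_hom_ext {A B : Bigraded R} {N : Type} [AddCommGroup N] [Module R N]
    {f g : (tensorBG A B).Tot →ₗ[R] N}
    (h : ∀ u v a i j b, f (totTensor A B (A.incl u v a) (B.incl i j b)) =
      g (totTensor A B (A.incl u v a) (B.incl i j b))) : f = g := by
  apply DirectSum.linearMap_ext R
  rintro ⟨I, J⟩
  refine DirectSum.linearMap_ext R (M := fun pq : ℤ × ℤ =>
    TensorProduct R (A.M pq.1 pq.2) (B.M (I - pq.1) (J - pq.2))) fun pq => ?_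
  apply TensorProduct.ext'
  intro a b
  have := h pq.1 pq.2 a (I - pq.1) (J - pq.2) b
  rw [totTensor_incl (I := I) (J := J) (by omega) (by omega)] at this
  exact this

theorem GMap.apply_cast {A B : Bigraded R} {p q : ℤ} (f : GMap A B p q) {i i' j j' : ℤ}
    (hi : i = i') (hj : j = j') (x : A.M i j) :
    f i' j' (A.cast hi hj x) = B.cast (by rw [hi]) (by rw [hj]) (f i j x) := by
  subst hi hj; rfl

theorem gtensor_tbridge_lof {A A' B B' : Bigraded R} {p q p' q' : ℤ}
    (f : GMap A A' p q) (g : GMap B B' p' q') (I J u v : ℤ) (a : A.M u v)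
    (b : B.M (I - u) (J - v)) :
    gtensor f g I J (tbridge A B I J
      (DirectSum.lof R (ℤ × ℤ)
        (fun pq => TensorProduct R (A.M pq.1 pq.2) (B.M (I - pq.1) (J - pq.2))) (u, v)
        (a ⊗ₜ[R] b))) =
      (Int.negOnePow (p' * u + q' * v) : ℤ) •
        tbridge A' B' (I + (p + p')) (J + (q + q'))
          (DirectSum.lof R (ℤ × ℤ)
            (fun pq => TensorProduct R (A'.M pq.1 pq.2)
              (B'.M (I + (p + p') - pq.1) (J + (q + q') - pq.2))) (u + p, v + q)
            (f u v a ⊗ₜ[R] B'.cast (by ring) (by ring) (g (I - u) (J - v) b))) := by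
  rw [← map_zsmul, ← map_zsmul]
  exact DirectSum.toModule_lof R (u, v) _

theorem totMap_gtensor {A A' B B' : Bigraded R} {p q p' q' : ℤ}
    (f : GMap A A' p q) (g : GMap B B' p' q') (u v : ℤ) (a : A.M u v) (y : B.Tot) :
    totMap (gtensor f g) (totTensor A B (A.incl u v a) y) =
      (Int.negOnePow (p' * u + q' * v) : ℤ) •
        totTensor A' B' (totMap f (A.incl u v a)) (totMap g y) := by
  suffices h : (totMap (gtensor f g)).comp (totTensor A B (A.incl u v a)) =
      (Int.negOnePow (p' * u + q' * v) : ℤ) •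
        (totTensor A' B' (totMap f (A.incl u v a))).comp (totMap g) from
    LinearMap.congr_fun h y
  apply Bigraded.tot_hom_ext
  intro i j b
  have hI : u + i + (p + p') = u + p + (i + p') := by ring
  have hJ : v + j + (q + q') = v + q + (j + q') := by ring
  rw [LinearMap.comp_apply, LinearMap.smul_apply, LinearMap.comp_apply, totTensor_incl rfl rfl,
    totMap_incl, totMap_incl, totMap_incl, totTensor_incl hI hJ, gtensor_tbridge_lof,
    map_zsmul, GMap.apply_cast, Bigraded.cast_cast]

theorem isTwMor_iff {A B : Bigraded R} (dA : WMap A A 0 1) (dB : WMap B B 0 1)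
    (f : WMap A B 0 0) :
    IsTwMor dA dB f ↔ ∀ m : ℕ,
      ∑ ij ∈ antidiagonal m, (totMap (dB ij.1)).comp (totMap (f ij.2)) =
        ∑ ij ∈ antidiagonal m, ((-1 : ℤ) ^ ij.1) •
          (totMap (f ij.1)).comp (totMap (dA ij.2)) := by
  refine forall_congr' fun m => ?_
  rw [← totMap_injective.eq_iff]
  simp only [map_sum, map_zsmul, totMap_grecast, totMap_gcomp]
  rw [Finset.sum_attach (antidiagonal m) fun ij => (totMap (dB ij.1)).comp (totMap (f ij.2)),
    Finset.sum_attach (antidiagonal m) fun ij => ((-1 : ℤ) ^ ij.1) •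
      (totMap (f ij.1)).comp (totMap (dA ij.2))]

theorem isVbMor_wtcD_iff {A B C : Bigraded R} (dA0 : GMap A A 0 1) (dB : WMap B B 0 1)
    (dC : WMap C C 0 1) (g : GMap A (wtcBG B C) 0 0) :
    IsVbMor dA0 (wtcD dB dC) g ↔ ∀ (u v : ℤ) (a : A.M u v) (m : ℕ),
      totMap (wdelta dB dC (g u v a : WMap B C (u + 0) (v + 0)) m) =
        totMap ((g (u + 0) (v + 1) (dA0 u v a) : WMap B C (u + 0 + 0) (v + 1 + 0)) m) := by
  have key : ∀ (u v : ℤ) (a : A.M u v) (m : ℕ),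
      totMap ((grecast 0 1 (by ring) (by ring) (gcomp (wtcD dB dC) g) u v a :
        WMap B C (u + 0) (v + 1)) m) =
        totMap (wdelta dB dC (g u v a : WMap B C (u + 0) (v + 0)) m) := by
    intro u v a m
    refine (totMap_wtcBG_cast (by ring) (by ring) (gcomp (wtcD dB dC) g u v a) m).trans ?_
    refine (totMap_wtcBG_cast (by ring) (by ring)
      (wtcD dB dC (u + 0) (v + 0) (g u v a)) m).trans ?_
    exact totMap_wrecast (by ring) (by ring)
      (wdelta dB dC (g u v a : WMap B C (u + 0) (v + 0))) m
  have key' : ∀ (u v : ℤ) (a : A.M u v) (m : ℕ),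
      totMap ((grecast 0 1 (by ring) (by ring) (gcomp g dA0) u v a :
        WMap B C (u + 0) (v + 1)) m) =
        totMap ((g (u + 0) (v + 1) (dA0 u v a) : WMap B C (u + 0 + 0) (v + 1 + 0)) m) := by
    intro u v a m
    refine (totMap_wtcBG_cast (by ring) (by ring) (gcomp g dA0 u v a) m).trans ?_
    exact totMap_wtcBG_cast (by ring) (by ring) (g (u + 0) (v + 1) (dA0 u v a)) m
  constructor
  · intro h u v a m
    rw [← key, ← key', h]
  · intro h
    funext u v
    refine LinearMap.ext fun a => funext fun m => totMap_injective ?_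
    rw [key, key', h]

theorem totMap_tildeMap {A B C : Bigraded R} (f : WMap (tensorBG A B) C 0 0) (u v : ℤ)
    (a : A.M u v) (m : ℕ) :
    totMap ((tildeMap f u v a : WMap B C (u + 0) (v + 0)) m) =
      (Int.negOnePow ((m : ℤ) * (v - u)) : ℤ) •
        (totMap (f m)).comp (totTensor A B (A.incl u v a)) := by
  apply Bigraded.tot_hom_ext
  intro i j b
  rw [LinearMap.smul_apply, LinearMap.comp_apply, totMap_incl, totTensor_incl rfl rfl,
    totMap_incl]
  have h : (tildeMap f u v a : WMap B C (u + 0) (v + 0)) m i j b =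
      (Int.negOnePow ((m : ℤ) * (v - u)) : ℤ) •
        C.cast (by ring) (by ring) (f m (u + i) (v + j) (tbridge A B (u + i) (v + j)
          (DirectSum.lof R (ℤ × ℤ)
            (fun pq => TensorProduct R (A.M pq.1 pq.2) (B.M (u + i - pq.1) (v + j - pq.2)))
            (u, v) (a ⊗ₜ[R] B.cast (by ring) (by ring) b)))) := rfl
  rw [h, map_zsmul, Bigraded.incl_cast]

theorem negOnePow_smul_inj {N : Type*} [AddCommGroup N] (n : ℤ) {x y : N} :
    (Int.negOnePow n : ℤ) • x = (Int.negOnePow n : ℤ) • y ↔ x = y := by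
  rcases Int.units_eq_one_or (Int.negOnePow n) with h | h <;> simp [h]

theorem tildeMap_injective {A B C : Bigraded R} :
    Function.Injective (tildeMap (A := A) (B := B) (C := C)) := by
  intro f f' h
  funext m
  apply totMap_injective
  apply tensorBG_hom_ext
  intro u v a i j b
  have h1 := totMap_tildeMap f u v a m
  rw [h, totMap_tildeMap] at h1
  exact (LinearMap.congr_fun ((negOnePow_smul_inj _).mp h1) (B.incl i j b)).symm

/-- The map `A ⊗ B → C` whose adjoint is `g`. -/
def untilde {A B C : Bigraded R} (g : GMap A (wtcBG B C) 0 0) : WMap (tensorBG A B) C 0 0 :=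
  fun m I J => DirectSum.toModule R (ℤ × ℤ) (C.M (I + (0 - (m : ℤ))) (J + (0 - (m : ℤ))))
    fun uv => TensorProduct.lift <| LinearMap.mk₂ R
      (fun (a : A.M uv.1 uv.2) (b : B.M (I - uv.1) (J - uv.2)) =>
        (Int.negOnePow ((m : ℤ) * (uv.2 - uv.1)) : ℤ) •
          C.cast (by ring) (by ring)
            ((g uv.1 uv.2 a : WMap B C (uv.1 + 0) (uv.2 + 0)) m (I - uv.1) (J - uv.2) b))
      (fun a a' b => by
        have h : (g uv.1 uv.2 (a + a') : WMap B C (uv.1 + 0) (uv.2 + 0)) m _ _ b =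
            (g uv.1 uv.2 a : WMap B C (uv.1 + 0) (uv.2 + 0)) m _ _ b +
              (g uv.1 uv.2 a' : WMap B C (uv.1 + 0) (uv.2 + 0)) m _ _ b := by
          rw [map_add]
          rfl
        rw [h, map_add, smul_add])
      (fun c a b => by
        have h : (g uv.1 uv.2 (c • a) : WMap B C (uv.1 + 0) (uv.2 + 0)) m _ _ b =
            c • (g uv.1 uv.2 a : WMap B C (uv.1 + 0) (uv.2 + 0)) m _ _ b := by
          rw [map_smul]
          rfl
        rw [h, map_smul, smul_comm c])
      (fun a b b' => by simp only [map_add, smul_add])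
      (fun c a b => by simp only [map_smul, smul_comm c])

theorem totMap_untilde {A B C : Bigraded R} (g : GMap A (wtcBG B C) 0 0) (u v : ℤ)
    (a : A.M u v) (m : ℕ) (y : B.Tot) :
    totMap (untilde g m) (totTensor A B (A.incl u v a) y) =
      (Int.negOnePow ((m : ℤ) * (v - u)) : ℤ) •
        totMap ((g u v a : WMap B C (u + 0) (v + 0)) m) y := by
  suffices h : (totMap (untilde g m)).comp (totTensor A B (A.incl u v a)) =
      (Int.negOnePow ((m : ℤ) * (v - u)) : ℤ) •
        totMap ((g u v a : WMap B C (u + 0) (v + 0)) m) from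
    LinearMap.congr_fun h y
  apply Bigraded.tot_hom_ext
  intro i j b
  rw [LinearMap.comp_apply, totTensor_incl rfl rfl, LinearMap.smul_apply, totMap_incl,
    totMap_incl]
  have h : untilde g m (u + i) (v + j) (tbridge A B (u + i) (v + j)
      (DirectSum.lof R (ℤ × ℤ)
        (fun pq => TensorProduct R (A.M pq.1 pq.2) (B.M (u + i - pq.1) (v + j - pq.2))) (u, v)
        (a ⊗ₜ[R] B.cast (by omega) (by omega) b))) =
      (Int.negOnePow ((m : ℤ) * (v - u)) : ℤ) •
        C.cast (by ring) (by ring) ((g u v a : WMap B C (u + 0) (v + 0)) m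
          (u + i - u) (v + j - v) (B.cast (by omega) (by omega) b)) :=
    DirectSum.toModule_lof R _ _
  rw [h, map_zsmul, Bigraded.incl_cast, GMap.apply_cast, Bigraded.incl_cast]

theorem tildeMap_untilde {A B C : Bigraded R} (g : GMap A (wtcBG B C) 0 0) :
    tildeMap (untilde g) = g := by
  funext u v
  refine LinearMap.ext fun a => funext fun m => totMap_injective ?_
  rw [totMap_tildeMap]
  refine LinearMap.ext fun y => ?_
  rw [LinearMap.smul_apply, LinearMap.comp_apply, totMap_untilde, smul_smul,
    Int.units_coe_mul_self, one_smul]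

theorem totMap_tensorD_vbW {A B : Bigraded R} (dA0 : GMap A A 0 1) (dB : WMap B B 0 1)
    (m : ℕ) (u v : ℤ) (a : A.M u v) (y : B.Tot) :
    totMap (tensorD (vbW dA0) dB m) (totTensor A B (A.incl u v a) y) =
      (if m = 0 then totTensor A B (totMap dA0 (A.incl u v a)) y else 0) +
        (Int.negOnePow ((0 - (m : ℤ)) * u + (1 - (m : ℤ)) * v) : ℤ) •
          totTensor A B (A.incl u v a) (totMap (dB m) y) := by
  have h : totMap (vbW dA0 m) = if m = 0 then totMap dA0 else 0 := by
    unfold vbW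
    split_ifs
    · rw [totMap_grecast]
    · rw [map_zero]
  rw [tensorD, map_add, totMap_grecast, totMap_grecast, LinearMap.add_apply, totMap_gtensor,
    totMap_gtensor, h, totMap_idG, totMap_idG]
  split_ifs <;> simp

theorem isTwMor_tensorD_vbW_iff {A B C : Bigraded R} (dA0 : GMap A A 0 1)
    (dB : WMap B B 0 1) (dC : WMap C C 0 1) (f : WMap (tensorBG A B) C 0 0) :
    IsTwMor (tensorD (vbW dA0) dB) dC f ↔
      ∀ (u v : ℤ) (a : A.M u v) (m : ℕ) (y : B.Tot),
        ∑ ij ∈ antidiagonal m, totMap (dC ij.1)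
            (totMap (f ij.2) (totTensor A B (A.incl u v a) y)) =
          (Int.negOnePow (m : ℤ) : ℤ) • totMap (f m)
            (totTensor A B (totMap dA0 (A.incl u v a)) y) +
          (Int.negOnePow v : ℤ) • ∑ ij ∈ antidiagonal m,
            (Int.negOnePow ((ij.1 : ℤ) + ij.2 * (v - u)) : ℤ) •
              totMap (f ij.1) (totTensor A B (A.incl u v a) (totMap (dB ij.2) y)) := by
  have hL : ∀ (u v : ℤ) (a : A.M u v) (m : ℕ) (y : B.Tot),
      (∑ ij ∈ antidiagonal m, (totMap (dC ij.1)).comp (totMap (f ij.2)))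
          (totTensor A B (A.incl u v a) y) =
        ∑ ij ∈ antidiagonal m, totMap (dC ij.1)
          (totMap (f ij.2) (totTensor A B (A.incl u v a) y)) := by
    intro u v a m y
    simp only [LinearMap.sum_apply, LinearMap.comp_apply]
  have hR : ∀ (u v : ℤ) (a : A.M u v) (m : ℕ) (y : B.Tot),
      (∑ ij ∈ antidiagonal m, ((-1 : ℤ) ^ ij.1) •
          (totMap (f ij.1)).comp (totMap (tensorD (vbW dA0) dB ij.2)))
          (totTensor A B (A.incl u v a) y) =
        (Int.negOnePow (m : ℤ) : ℤ) • totMap (f m)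
            (totTensor A B (totMap dA0 (A.incl u v a)) y) +
          (Int.negOnePow v : ℤ) • ∑ ij ∈ antidiagonal m,
            (Int.negOnePow ((ij.1 : ℤ) + ij.2 * (v - u)) : ℤ) •
              totMap (f ij.1) (totTensor A B (A.incl u v a) (totMap (dB ij.2) y)) := by
    intro u v a m y
    have sgn : ∀ n : ℕ, (-1 : ℤ) ^ n = (Int.negOnePow (n : ℤ) : ℤ) := fun n => by
      simp [Int.negOnePow_def]
    simp only [LinearMap.sum_apply, LinearMap.smul_apply, LinearMap.comp_apply,
      totMap_tensorD_vbW, map_add, smul_add, Finset.sum_add_distrib, sgn]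
    congr 1
    · rw [Finset.sum_eq_single (m, 0)]
      · rw [if_pos rfl]
      · rintro ⟨i, j⟩ hij hne
        have hj : j ≠ 0 := by
          rintro rfl
          exact hne (by simpa using hij)
        simp only [if_neg hj, map_zero, smul_zero]
      · intro h
        simp at h
    · rw [Finset.smul_sum]
      refine Finset.sum_congr rfl fun ij _ => ?_
      rw [map_zsmul, smul_smul, smul_smul, ← Units.val_mul, ← Units.val_mul,
        ← Int.negOnePow_add, ← Int.negOnePow_add]
      congr 2
      rw [Int.negOnePow_eq_iff]
      exact ⟨-(ij.2 * v), by ring⟩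
  rw [isTwMor_iff]
  constructor
  · intro h u v a m y
    rw [← hL, ← hR, h]
  · intro h m
    apply tensorBG_hom_ext
    intro u v a i j b
    rw [hL, hR, h]

theorem totMap_wdelta_tildeMap {A B C : Bigraded R} (dB : WMap B B 0 1) (dC : WMap C C 0 1)
    (f : WMap (tensorBG A B) C 0 0) (u v : ℤ) (a : A.M u v) (m : ℕ) (y : B.Tot) :
    totMap (wdelta dB dC (tildeMap f u v a : WMap B C (u + 0) (v + 0)) m) y =
      (Int.negOnePow ((m : ℤ) * (v - u)) : ℤ) •
        (∑ ij ∈ antidiagonal m, totMap (dC ij.1)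
            (totMap (f ij.2) (totTensor A B (A.incl u v a) y)) -
          (Int.negOnePow v : ℤ) • ∑ ij ∈ antidiagonal m,
            (Int.negOnePow ((ij.1 : ℤ) + ij.2 * (v - u)) : ℤ) •
              totMap (f ij.1) (totTensor A B (A.incl u v a) (totMap (dB ij.2) y))) := by
  suffices key : ∀ w : WMap B C (u + 0) (v + 0),
      (∀ n : ℕ, totMap (w n) = (Int.negOnePow ((n : ℤ) * (v - u)) : ℤ) •
        (totMap (f n)).comp (totTensor A B (A.incl u v a))) →
      totMap (wdelta dB dC w m) y =
        (Int.negOnePow ((m : ℤ) * (v - u)) : ℤ) •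
          (∑ ij ∈ antidiagonal m, totMap (dC ij.1)
              (totMap (f ij.2) (totTensor A B (A.incl u v a) y)) -
            (Int.negOnePow v : ℤ) • ∑ ij ∈ antidiagonal m,
              (Int.negOnePow ((ij.1 : ℤ) + ij.2 * (v - u)) : ℤ) •
                totMap (f ij.1) (totTensor A B (A.incl u v a) (totMap (dB ij.2) y))) from
    key _ (totMap_tildeMap f u v a)
  intro w hw
  rw [totMap_wdelta]
  simp only [hw, LinearMap.sub_apply, LinearMap.sum_apply, LinearMap.smul_apply,
    LinearMap.comp_apply, map_zsmul, smul_sub, Finset.smul_sum, smul_smul]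
  simp only [← Units.val_mul, ← Int.negOnePow_add]
  congr 1
  · refine Finset.sum_congr rfl fun ij hij => ?_
    have hm : (m : ℤ) = ij.1 + ij.2 := by exact_mod_cast (mem_antidiagonal.mp hij).symm
    congr 3
    rw [hm]
    ring
  · refine Finset.sum_congr rfl fun ij hij => ?_
    have hm : (m : ℤ) = ij.1 + ij.2 := by exact_mod_cast (mem_antidiagonal.mp hij).symm
    congr 2
    rw [Int.negOnePow_eq_iff, hm]
    exact ⟨-(ij.2 * (v - u)), by ring⟩

theorem isTwMor_iff_isVbMor_tildeMap {A B C : Bigraded R} (dA0 : GMap A A 0 1)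
    (dB : WMap B B 0 1) (dC : WMap C C 0 1) (f : WMap (tensorBG A B) C 0 0) :
    IsTwMor (tensorD (vbW dA0) dB) dC f ↔ IsVbMor dA0 (wtcD dB dC) (tildeMap f) := by
  rw [isTwMor_tensorD_vbW_iff, isVbMor_wtcD_iff]
  refine forall_congr' fun u => forall_congr' fun v => forall_congr' fun a =>
    forall_congr' fun m => ?_
  rw [LinearMap.ext_iff]
  refine forall_congr' fun y => ?_
  have sgn : Int.negOnePow ((m : ℤ) * (v + 1 - (u + 0))) =
      Int.negOnePow ((m : ℤ) * (v - u)) * Int.negOnePow (m : ℤ) := by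
    rw [← Int.negOnePow_add]
    congr 1
    ring
  rw [totMap_wdelta_tildeMap, totMap_tildeMap, LinearMap.smul_apply, LinearMap.comp_apply,
    ← totMap_incl, sgn, Units.val_mul, mul_smul, negOnePow_smul_inj, sub_eq_iff_eq_add]

/-- **Statement 12.** Let `A` be a vertical bicomplex (viewed as a twisted complex
concentrated in `d_0`) and `B, C` twisted complexes.  Then `f ↦ f̃`, where
`(f̃(a))_m(b) = (-1)^{m|a|} f_m(a ⊗ b)`, is a bijection from morphisms of twisted complexes
`A ⊗ B → C` onto morphisms of vertical bicomplexes `A → wtc(B,C)`; in particular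
`δ(f̃(a)) = f̃(d^A(a))`. -/
theorem tensor_hom_adjunction {R : Type} [CommRing R] (A : Bigraded R)
    (dA0 : GMap A A 0 1) (hdA : gcomp dA0 dA0 = 0) (B C : TwComplex R) :
    Set.BijOn (tildeMap (A := A) (B := B.toBigraded) (C := C.toBigraded))
      {f | IsTwMor (tensorD (vbW dA0) B.d) C.d f}
      {g | IsVbMor dA0 (wtcD B.d C.d) g} := by
  refine ⟨fun f hf => (isTwMor_iff_isVbMor_tildeMap dA0 B.d C.d f).mp hf,
    tildeMap_injective.injOn, fun g hg => ⟨untilde g, ?_, tildeMap_untilde g⟩⟩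
  refine (isTwMor_iff_isVbMor_tildeMap dA0 B.d C.d (untilde g)).mpr ?_
  rw [tildeMap_untilde]
  exact hg
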